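/- Let m, n ≥ 5 and set N = m+n if m = n, and N = m+n−1 if n ≥ m+1. If a red/blue edge-coloring of K_{N,N} contains neither a blue C_{2n} nor a red C_{2m}, then the blue graph contains no complete bipartite subgraph K_{n−1, n−1}. -/

import Mathlib

def hasCycleLength {V : Type*} (G : SimpleGraph V) (l : ℕ) : Prop :=
  ∃ (v : V) (p : G.Walk v v), p.IsCycle ∧ p.length = l

theorem ZMod.natCast_inj_of_lt {k i j : ℕ} (hi : i < k) (hj : j < k)
    (h : (i : ZMod k) = (j : ZMod k)) : i = j := by
  have := congrArg ZMod.val h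
  rwa [ZMod.val_natCast_of_lt hi, ZMod.val_natCast_of_lt hj] at this

/-- The relation `R`, viewed as a bipartite graph, has a cycle on `2 * k` vertices that uses only
vertices of `P` and `Q`: it is `a 0, b 0, a 1, b 1, …`, with indices read modulo `k`. -/
def HasBipartiteCycleOn {α β : Type*} (k : ℕ) (R : α → β → Prop) (P : Finset α) (Q : Finset β) :
    Prop :=
  ∃ (a : ZMod k → α) (b : ZMod k → β), a.Injective ∧ b.Injective ∧ (∀ j, a j ∈ P) ∧
    (∀ j, b j ∈ Q) ∧ (∀ j, R (a j) (b j)) ∧ ∀ j, R (a (j + 1)) (b j)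

namespace HasBipartiteCycleOn

variable {α β : Type*} {k : ℕ} {R : α → β → Prop} {P : Finset α} {Q : Finset β}

theorem mono {P' : Finset α} {Q' : Finset β} (h : HasBipartiteCycleOn k R P Q) (hP : P ⊆ P')
    (hQ : Q ⊆ Q') : HasBipartiteCycleOn k R P' Q' := by
  obtain ⟨a, b, ha, hb, haP, hbQ, h₁, h₂⟩ := h
  exact ⟨a, b, ha, hb, fun j => hP (haP j), fun j => hQ (hbQ j), h₁, h₂⟩

theorem flip (h : HasBipartiteCycleOn k R P Q) :
    HasBipartiteCycleOn k (fun b a => R a b) Q P := by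
  obtain ⟨a, b, ha, hb, haP, hbQ, h₁, h₂⟩ := h
  exact ⟨b, fun j => a (j + 1), hb, fun i j hij => add_right_cancel (ha hij), hbQ,
    fun j => haP _, h₂, fun j => h₁ _⟩

theorem of_nat (hk : 2 ≤ k) (a : ℕ → α) (b : ℕ → β)
    (ha : ∀ i < k, ∀ j < k, a i = a j → i = j) (hb : ∀ i < k, ∀ j < k, b i = b j → i = j)
    (haP : ∀ i < k, a i ∈ P) (hbQ : ∀ i < k, b i ∈ Q) (h₁ : ∀ i < k, R (a i) (b i))
    (h₂ : ∀ i, i + 1 < k → R (a (i + 1)) (b i)) (h₃ : R (a 0) (b (k - 1))) :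
    HasBipartiteCycleOn k R P Q := by
  have : NeZero k := ⟨by omega⟩
  have : Fact (1 < k) := ⟨by omega⟩
  refine ⟨fun j => a j.val, fun j => b j.val, fun i j hij => ?_, fun i j hij => ?_,
    fun j => haP _ j.val_lt, fun j => hbQ _ j.val_lt, fun j => h₁ _ j.val_lt, fun j => ?_⟩
  · exact ZMod.val_injective k (ha _ i.val_lt _ j.val_lt hij)
  · exact ZMod.val_injective k (hb _ i.val_lt _ j.val_lt hij)
  · have hj := j.val_lt
    show R (a (j + 1).val) (b j.val)
    rw [ZMod.val_add, ZMod.val_one]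
    rcases Nat.lt_or_ge (j.val + 1) k with h | h
    · rw [Nat.mod_eq_of_lt h]
      exact h₂ _ h
    · have hjk : j.val = k - 1 := by omega
      rw [hjk, Nat.sub_add_cancel (by omega), Nat.mod_self]
      exact h₃

open Classical in
/-- The rotation step in Ore's theorem for bipartite graphs: if the two ends of a Hamiltonian path
have degree sum at least `k + 1`, then there is a Hamiltonian cycle. -/
theorem of_path (hk : 2 ≤ k) (hQ : Q.card = k) (hP : P.card = k) (a : ℕ → α) (b : ℕ → β)
    (ha : ∀ i < k, ∀ j < k, a i = a j → i = j) (hb : ∀ i < k, ∀ j < k, b i = b j → i = j)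
    (haP : ∀ i < k, a i ∈ P) (hbQ : ∀ i < k, b i ∈ Q) (h₁ : ∀ i < k, R (a i) (b i))
    (h₂ : ∀ i, i + 1 < k → R (a (i + 1)) (b i))
    (hdeg : k + 1 ≤ (Q.filter fun y => R (a 0) y).card +
      (P.filter fun x => R x (b (k - 1))).card) :
    HasBipartiteCycleOn k R P Q := by
  set I := (Finset.range k).filter fun i => R (a 0) (b i)
  set J := (Finset.range k).filter fun i => R (a i) (b (k - 1))
  have hQim : Q = (Finset.range k).image b := by
    refine (Finset.eq_of_subset_of_card_le ?_ ?_).symm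
    · intro y hy
      obtain ⟨i, hi, rfl⟩ := Finset.mem_image.1 hy
      exact hbQ i (Finset.mem_range.1 hi)
    · rw [Finset.card_image_of_injOn, Finset.card_range, hQ]
      intro i hi j hj
      exact hb i (by simpa using hi) j (by simpa using hj)
  have hPim : P = (Finset.range k).image a := by
    refine (Finset.eq_of_subset_of_card_le ?_ ?_).symm
    · intro y hy
      obtain ⟨i, hi, rfl⟩ := Finset.mem_image.1 hy
      exact haP i (Finset.mem_range.1 hi)
    · rw [Finset.card_image_of_injOn, Finset.card_range, hP]
      intro i hi j hj
      exact ha i (by simpa using hi) j (by simpa using hj)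
  have hI : (Q.filter fun y => R (a 0) y).card ≤ I.card := by
    rw [hQim, Finset.filter_image]
    exact Finset.card_image_le
  have hJ : (P.filter fun x => R x (b (k - 1))).card ≤ J.card := by
    rw [hPim, Finset.filter_image]
    exact Finset.card_image_le
  have hIJ : (I ∩ J).Nonempty := by
    rw [← Finset.card_pos]
    have h := Finset.card_union_add_card_inter I J
    have h' : (I ∪ J).card ≤ k := by
      have := Finset.card_le_card (Finset.union_subset (Finset.filter_subset _ _)
        (Finset.filter_subset _ _) : I ∪ J ⊆ Finset.range k)
      simpa using this
    omega
  obtain ⟨i, hi⟩ := hIJ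
  simp only [I, J, Finset.mem_inter, Finset.mem_filter, Finset.mem_range] at hi
  obtain ⟨⟨hik, hiI⟩, -, hiJ⟩ := hi
  refine of_nat hk (fun j => if j ≤ i then a j else a (k + i - j))
    (fun j => if j < i then b j else b (k - 1 + i - j)) ?_ ?_ ?_ ?_ ?_ ?_ ?_
  · intro x hx y hy hxy
    split_ifs at hxy with h h' h' <;> have := ha _ (by omega) _ (by omega) hxy <;> omega
  · intro x hx y hy hxy
    split_ifs at hxy with h h' h' <;> have := hb _ (by omega) _ (by omega) hxy <;> omega
  · intro x hx
    split_ifs <;> exact haP _ (by omega)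
  · intro x hx
    split_ifs <;> exact hbQ _ (by omega)
  · intro x hx
    rcases lt_trichotomy x i with h | rfl | h
    · rw [if_pos h.le, if_pos h]
      exact h₁ _ hx
    · rw [if_pos le_rfl, if_neg (lt_irrefl _)]
      simpa using hiJ
    · rw [if_neg (by omega), if_neg (by omega),
        show k + i - x = (k - 1 + i - x) + 1 by omega]
      exact h₂ _ (by omega)
  · intro x hx
    rcases lt_or_ge x i with h | h
    · rw [if_pos (by omega), if_pos h]
      exact h₂ _ hx
    · rw [if_neg (by omega), if_neg (by omega), show k + i - (x + 1) = k - 1 + i - x by omega]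
      exact h₁ _ (by omega)
  · rw [if_pos (Nat.zero_le _), if_neg (by omega), show k - 1 + i - (k - 1) = i by omega]
    exact hiI

open Classical in
/-- Bondy–Chvátal closure for balanced bipartite graphs: joining two nonadjacent vertices whose
degree sum is at least `k + 1` does not create the first Hamiltonian cycle. -/
theorem of_insert_edge (hk : 2 ≤ k) (hP : P.card = k) (hQ : Q.card = k) {p : α} {q : β}
    (hdeg : k + 1 ≤ (Q.filter fun y => R p y).card + (P.filter fun x => R x q).card)
    (h : HasBipartiteCycleOn k (fun x y => R x y ∨ x = p ∧ y = q) P Q) :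
    HasBipartiteCycleOn k R P Q := by
  have : NeZero k := ⟨by omega⟩
  have : Fact (1 < k) := ⟨by omega⟩
  have main : ∀ (a : ZMod k → α) (b : ZMod k → β), a.Injective → b.Injective →
      (∀ j, a j ∈ P) → (∀ j, b j ∈ Q) → (∀ j, R (a j) (b j) ∨ a j = p ∧ b j = q) →
      (∀ j, R (a (j + 1)) (b j) ∨ a (j + 1) = p ∧ b j = q) →
      (∃ j, a (j + 1) = p ∧ b j = q) → HasBipartiteCycleOn k R P Q := by
    rintro a b ha hb haP hbQ h₁ h₂ ⟨r, rfl, rfl⟩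
    have hlast : r + 1 + ((k - 1 : ℕ) : ZMod k) = r := by
      rw [Nat.cast_sub (by omega), ZMod.natCast_self]
      push_cast
      ring
    refine of_path hk hQ hP (fun i => a (r + 1 + i)) (fun i => b (r + 1 + i)) ?_ ?_
      (fun _ _ => haP _) (fun _ _ => hbQ _) ?_ ?_ ?_
    · exact fun i hi j hj hij => ZMod.natCast_inj_of_lt hi hj (add_left_cancel (ha hij))
    · exact fun i hi j hj hij => ZMod.natCast_inj_of_lt hi hj (add_left_cancel (hb hij))
    · intro i hi
      rcases h₁ (r + 1 + i) with h | ⟨h, h'⟩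
      · exact h
      · have e := ha h
        have e' := hb h'
        rw [e] at e'
        exact absurd (add_eq_left.1 e') one_ne_zero
    · intro i hi
      rcases h₂ (r + 1 + i) with h | ⟨-, h'⟩
      · simpa [add_assoc] using h
      · exfalso
        have e' := (hb h').trans hlast.symm
        have := ZMod.natCast_inj_of_lt (by omega) (by omega) (add_left_cancel e')
        omega
    · simpa [hlast] using hdeg
  obtain ⟨a, b, ha, hb, haP, hbQ, h₁, h₂⟩ := h
  by_cases hj : ∃ j, a (j + 1) = p ∧ b j = q
  · exact main a b ha hb haP hbQ h₁ h₂ hj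
  by_cases hj' : ∃ j, a j = p ∧ b j = q
  · refine main (fun j => a (-j)) (fun j => b (-1 - j)) (fun i j h => neg_injective (ha h))
      (fun i j h => sub_right_injective (hb h)) (fun _ => haP _) (fun _ => hbQ _) ?_ ?_ ?_
    · intro j
      have := h₂ (-1 - j)
      rwa [show -1 - j + 1 = -j by ring] at this
    · intro j
      have := h₁ (-1 - j)
      rwa [show -1 - j = -(j + 1) by ring] at this ⊢
    · obtain ⟨j, rfl, rfl⟩ := hj'
      refine ⟨-j - 1, ?_, ?_⟩ <;> congr 1 <;> ring
  · push Not at hj hj'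
    exact ⟨a, b, ha, hb, haP, hbQ, fun j => (h₁ j).resolve_right fun h => hj' j h.1 h.2,
      fun j => (h₂ j).resolve_right fun h => hj j h.1 h.2⟩

theorem of_forall (hk : 2 ≤ k) (hP : P.card = k) (hQ : Q.card = k)
    (h : ∀ p ∈ P, ∀ q ∈ Q, R p q) : HasBipartiteCycleOn k R P Q := by
  have : NeZero k := ⟨by omega⟩
  have e : ZMod k ≃ P := Fintype.equivOfCardEq (by simp [ZMod.card, hP])
  have e' : ZMod k ≃ Q := Fintype.equivOfCardEq (by simp [ZMod.card, hQ])
  exact ⟨fun j => e j, fun j => e' j, Subtype.val_injective.comp e.injective,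
    Subtype.val_injective.comp e'.injective, fun j => (e j).2, fun j => (e' j).2,
    fun j => h _ (e j).2 _ (e' j).2, fun j => h _ (e (j + 1)).2 _ (e' j).2⟩

open Classical in
/-- A balanced bipartite graph whose Bondy–Chvátal closure is complete is Hamiltonian. -/
theorem of_closure (hk : 2 ≤ k) (hP : P.card = k) (hQ : Q.card = k)
    (h : ∀ R' : α → β → Prop, (∀ x y, R x y → R' x y) →
      (∀ p ∈ P, ∀ q ∈ Q,
        k + 1 ≤ (Q.filter fun y => R' p y).card + (P.filter fun x => R' x q).card → R' p q) →
      ∀ p ∈ P, ∀ q ∈ Q, R' p q) : HasBipartiteCycleOn k R P Q := by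
  induction hd : ((P ×ˢ Q).filter fun z => ¬ R z.1 z.2).card using Nat.strong_induction_on
    generalizing R with
  | _ d ih =>
    by_cases hc : ∀ p ∈ P, ∀ q ∈ Q,
        k + 1 ≤ (Q.filter fun y => R p y).card + (P.filter fun x => R x q).card → R p q
    · exact of_forall hk hP hQ (h R (fun _ _ => id) hc)
    · push Not at hc
      obtain ⟨p, hp, q, hq, hdeg, hpq⟩ := hc
      refine of_insert_edge hk hP hQ hdeg (ih _ ?_ (fun R' hR' => h R' fun x y hxy =>
        hR' x y (Or.inl hxy)) rfl)
      rw [← hd]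
      refine Finset.card_lt_card (Finset.ssubset_iff_of_subset ?_ |>.2 ⟨(p, q), ?_, ?_⟩)
      · intro z hz
        simp only [Finset.mem_filter, not_or] at hz ⊢
        exact ⟨hz.1, hz.2.1⟩
      · simp [hp, hq, hpq]
      · simp

/-- A cycle of a relation gives a cycle in any graph on the disjoint union containing it. -/
theorem toHasCycleLength {G : SimpleGraph (α ⊕ β)} (hk : 2 ≤ k)
    (h : HasBipartiteCycleOn k R P Q) (hG : ∀ x y, R x y → G.Adj (Sum.inl x) (Sum.inr y)) :
    hasCycleLength G (2 * k) := by
  obtain ⟨a, b, ha, hb, -, -, h₁, h₂⟩ := h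
  let f : Fin (2 * k) → α ⊕ β := fun i =>
    if i.val % 2 = 0 then Sum.inl (a ((i.val / 2 : ℕ) : ZMod k))
    else Sum.inr (b ((i.val / 2 : ℕ) : ZMod k))
  have hstep : ∀ u v : Fin (2 * k), (u - v).val = 1 → G.Adj (f v) (f u) := by
    intro u v huv
    have hu := u.isLt
    have hv := v.isLt
    have hcases : u.val = v.val + 1 ∨ v.val = 2 * k - 1 ∧ u.val = 0 := by
      rcases le_or_gt v u with h | h
      · rw [Fin.coe_sub_iff_le.2 h] at huv
        have : v.val ≤ u.val := h
        omega
      · rw [Fin.coe_sub_iff_lt.2 h] at huv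
        have : u.val < v.val := h
        omega
    have hfa : ∀ w : Fin (2 * k), w.val % 2 = 0 →
        f w = Sum.inl (a ((w.val / 2 : ℕ) : ZMod k)) := fun w hw => if_pos hw
    have hfb : ∀ w : Fin (2 * k), ¬ w.val % 2 = 0 →
        f w = Sum.inr (b ((w.val / 2 : ℕ) : ZMod k)) := fun w hw => if_neg hw
    rcases hcases with hc | ⟨hc, hc'⟩
    · by_cases hpar : v.val % 2 = 0
      · rw [hfa v hpar, hfb u (by omega), show u.val / 2 = v.val / 2 by omega]
        exact hG _ _ (h₁ _)
      · rw [hfb v hpar, hfa u (by omega), show u.val / 2 = v.val / 2 + 1 by omega, Nat.cast_add,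
          Nat.cast_one]
        exact (hG _ _ (h₂ _)).symm
    · rw [hfb v (by omega), hfa u (by omega), hc', show v.val / 2 = k - 1 by omega]
      have := h₂ ((k - 1 : ℕ) : ZMod k)
      rw [← Nat.cast_succ, Nat.succ_eq_add_one, Nat.sub_add_cancel (by omega),
        ZMod.natCast_self] at this
      simpa using (hG _ _ this).symm
  refine (SimpleGraph.cycleGraph_isContained_iff (by omega)).1 ⟨⟨⟨f, ?_⟩, ?_⟩⟩
  · intro u v huv
    rcases SimpleGraph.cycleGraph_adj'.1 huv with h | h
    · exact (hstep u v h).symm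
    · exact hstep v u h
  · intro u v huv
    have hu := u.isLt
    have hv := v.isLt
    change f u = f v at huv
    simp only [f] at huv
    apply Fin.ext
    split_ifs at huv with h h' h'
    · have := ZMod.natCast_inj_of_lt (by omega) (by omega) (ha (Sum.inl_injective huv))
      omega
    · have := ZMod.natCast_inj_of_lt (by omega) (by omega) (hb (Sum.inr_injective huv))
      omega

open Classical in
/-- If, apart from one vertex of `Q` with at least two neighbours, every vertex of `Q` misses at
most `k - 3` vertices of `P` and every vertex of `P` misses at most one vertex of `Q`, then there is
a cycle through all of `Q`. -/
theorem of_few_missing (hk : 3 ≤ k) (hP : k ≤ P.card) (hQ : Q.card = k) {q₀ : β} (hq₀ : q₀ ∈ Q)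
    (h₀ : 2 ≤ (P.filter fun x => R x q₀).card)
    (hfew : ∀ q ∈ Q, q ≠ q₀ → (P.filter fun x => ¬ R x q).card + 3 ≤ k)
    (hone : ∀ p ∈ P, ∀ q ∈ Q, q ≠ q₀ → ∀ q' ∈ Q, q' ≠ q₀ → ¬ R p q → ¬ R p q' → q = q') :
    HasBipartiteCycleOn k R P Q := by
  obtain ⟨U, hUP, hU⟩ := Finset.exists_subset_card_eq h₀
  obtain ⟨P', hUP', hP'P, hP'⟩ := Finset.exists_subsuperset_card_eq
    (hUP.trans (Finset.filter_subset _ _)) (by omega : U.card ≤ k) hP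
  refine mono ?_ hP'P subset_rfl
  refine of_closure (by omega) hP' hQ fun R' hR' hcl => ?_
  have hdegP : ∀ p, (Q.filter fun y => R' p y).card + (Q.filter fun y => ¬ R' p y).card = k :=
    fun p => by rw [← hQ]; exact Finset.card_filter_add_card_filter_not _
  have hdegQ : ∀ q, (P'.filter fun x => R' x q).card + (P'.filter fun x => ¬ R' x q).card = k :=
    fun q => by rw [← hP']; exact Finset.card_filter_add_card_filter_not _
  have hne : ∀ p ∈ P', ∀ q ∈ Q, q ≠ q₀ → R' p q := by
    intro p hp q hq hqne
    by_contra hpq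
    refine hpq (hcl p hp q hq ?_)
    have h₁ : (Q.filter fun y => ¬ R' p y) ⊆ {q, q₀} := by
      intro y hy
      rw [Finset.mem_filter] at hy
      by_cases hyq : y = q₀
      · simp [hyq]
      · simp [hone p (hP'P hp) y hy.1 hyq q hq hqne (fun h => hy.2 (hR' _ _ h))
          fun h => hpq (hR' _ _ h)]
    have h₂ := (Finset.card_le_card h₁).trans Finset.card_le_two
    have h₃ : (P'.filter fun x => ¬ R' x q) ⊆ P.filter fun x => ¬ R x q := by
      intro x hx
      rw [Finset.mem_filter] at hx ⊢
      exact ⟨hP'P hx.1, fun h => hx.2 (hR' _ _ h)⟩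
    have h₄ := Finset.card_le_card h₃
    have := hfew q hq hqne
    have := hdegP p
    have := hdegQ q
    omega
  intro p hp q hq
  by_cases hqne : q = q₀
  · subst hqne
    refine hcl p hp q hq ?_
    have h₁ : (Q.filter fun y => ¬ R' p y) ⊆ {q} := by
      intro y hy
      rw [Finset.mem_filter] at hy
      by_contra hyq
      exact hy.2 (hne p hp y hy.1 (by simpa using hyq))
    have h₂ := Finset.card_le_card h₁
    rw [Finset.card_singleton] at h₂
    have h₃ : U ⊆ P'.filter fun x => R' x q := by
      intro x hx
      exact Finset.mem_filter.2 ⟨hUP' hx, hR' _ _ (Finset.mem_filter.1 (hUP hx)).2⟩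
    have h₄ := Finset.card_le_card h₃
    have := hdegP p
    omega
  · exact hne p hp q hq hqne

open Classical in
/-- A complete bipartite graph on parts of size `k - 1`, with one vertex added on each side, is
Hamiltonian as soon as both added vertices have degree at least two. -/
theorem of_insert_insert [DecidableEq α] [DecidableEq β] (hk : 3 ≤ k) (hP : P.card = k - 1)
    (hQ : Q.card = k - 1) {x : α} {y : β} (hx : x ∉ P) (hy : y ∉ Q)
    (hR : ∀ p ∈ P, ∀ q ∈ Q, R p q)
    (hdx : 2 ≤ ((insert y Q).filter fun q => R x q).card)
    (hdy : 2 ≤ ((insert x P).filter fun p => R p y).card) :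
    HasBipartiteCycleOn k R (insert x P) (insert y Q) := by
  refine of_closure (by omega) (by rw [Finset.card_insert_of_notMem hx]; omega)
    (by rw [Finset.card_insert_of_notMem hy]; omega) fun R' hR' hcl => ?_
  have hdx' : 2 ≤ ((insert y Q).filter fun q => R' x q).card :=
    hdx.trans (Finset.card_le_card (Finset.monotone_filter_right _ fun _ _ h => hR' _ _ h))
  have hdy' : 2 ≤ ((insert x P).filter fun p => R' p y).card :=
    hdy.trans (Finset.card_le_card (Finset.monotone_filter_right _ fun _ _ h => hR' _ _ h))
  have hdegP : ∀ p, (∀ q ∈ Q, R' p q) → k - 1 ≤ ((insert y Q).filter fun q => R' p q).card := by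
    intro p hp
    rw [← hQ]
    refine Finset.card_le_card fun q hq => ?_
    simp [hq, hp q hq]
  have hdegQ : ∀ q, (∀ p ∈ P, R' p q) → k - 1 ≤ ((insert x P).filter fun p => R' p q).card := by
    intro q hq
    rw [← hP]
    refine Finset.card_le_card fun p hp => ?_
    simp [hp, hq p hp]
  have hRy : ∀ p ∈ P, R' p y := by
    intro p hp
    refine hcl p (by simp [hp]) y (by simp) ?_
    have := hdegP p fun q hq => hR' _ _ (hR p hp q hq)
    omega
  have hRx : ∀ q ∈ Q, R' x q := by
    intro q hq
    refine hcl x (by simp) q (by simp [hq]) ?_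
    have := hdegQ q fun p hp => hR' _ _ (hR p hp q hq)
    omega
  intro p hp q hq
  rcases Finset.mem_insert.1 hp with rfl | hp <;> rcases Finset.mem_insert.1 hq with rfl | hq
  · refine hcl _ (by simp) _ (by simp) ?_
    have := hdegP _ hRx
    have := hdegQ _ hRy
    omega
  · exact hRx q hq
  · exact hRy p hp
  · exact hR' _ _ (hR p hp q hq)

open Classical in
theorem card_missing_add_card_missing_le {q q' : β} (hq : q ∈ Q) (hq' : q' ∈ Q)
    (hone : ∀ p ∈ P, ∀ q ∈ Q, ∀ q' ∈ Q, ¬ R p q → ¬ R p q' → q = q') (hne : q ≠ q') :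
    (P.filter fun x => ¬ R x q).card + (P.filter fun x => ¬ R x q').card ≤ P.card := by
  rw [← Finset.card_union_of_disjoint]
  · exact Finset.card_le_card
      (Finset.union_subset (Finset.filter_subset _ _) (Finset.filter_subset _ _))
  · rw [Finset.disjoint_left]
    intro x hx hx'
    rw [Finset.mem_filter] at hx hx'
    exact hne (hone x hx.1 q hq q' hq' hx.2 hx'.2)

open Classical in
theorem exists_forall_ne_card_missing_le (hk : 5 ≤ k) (hP : P.card = k) (hQ : Q.Nonempty)
    (hone : ∀ p ∈ P, ∀ q ∈ Q, ∀ q' ∈ Q, ¬ R p q → ¬ R p q' → q = q') :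
    ∃ q₁ ∈ Q, ∀ q ∈ Q, q ≠ q₁ → (P.filter fun x => ¬ R x q).card + 3 ≤ k := by
  obtain ⟨q₁, hq₁, hmax⟩ := Q.exists_max_image (fun q => (P.filter fun x => ¬ R x q).card) hQ
  refine ⟨q₁, hq₁, fun q hq hne => ?_⟩
  have := hmax q hq
  have := card_missing_add_card_missing_le hq hq₁ hone hne
  omega

open Classical in
theorem of_missing_at_most_one_insert (hk : 5 ≤ k) (hP : P.card = k) (hQ : k ≤ Q.card) {y : β}
    (hy : y ∉ Q) (hone : ∀ p ∈ P, ∀ q ∈ Q, ∀ q' ∈ Q, ¬ R p q → ¬ R p q' → q = q')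
    (hdy : 2 ≤ (P.filter fun x => R x y).card) :
    HasBipartiteCycleOn k R P (insert y Q) := by
  obtain ⟨q₁, hq₁, hfew⟩ := exists_forall_ne_card_missing_le hk hP
    (Finset.card_pos.1 (by omega)) hone
  obtain ⟨Q', hQ', hcard⟩ := Finset.exists_subset_card_eq
    (show k - 1 ≤ (Q.erase q₁).card by rw [Finset.card_erase_of_mem hq₁]; omega)
  have hQ'Q : Q' ⊆ Q := hQ'.trans (Finset.erase_subset _ _)
  refine mono (of_few_missing (q₀ := y) (Q := insert y Q') (by omega) hP.ge ?_ (by simp) hdy ?_ ?_)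
    subset_rfl (Finset.insert_subset_insert _ hQ'Q)
  · rw [Finset.card_insert_of_notMem fun h => hy (hQ'Q h)]
    omega
  · intro q hq hqy
    have hq' := Finset.mem_of_mem_insert_of_ne hq hqy
    exact hfew q (hQ'Q hq') (Finset.ne_of_mem_erase (hQ' hq'))
  · intro p hp q hq hqy q' hq' hqy'
    exact hone p hp q (hQ'Q (Finset.mem_of_mem_insert_of_ne hq hqy)) q'
      (hQ'Q (Finset.mem_of_mem_insert_of_ne hq' hqy'))

open Classical in
theorem of_missing_at_most_one (hk : 5 ≤ k) (hP : k ≤ P.card) (hQ : k + 1 ≤ Q.card)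
    (hone : ∀ p ∈ P, ∀ q ∈ Q, ∀ q' ∈ Q, ¬ R p q → ¬ R p q' → q = q') :
    HasBipartiteCycleOn k R P Q := by
  obtain ⟨P', hP'P, hP'⟩ := Finset.exists_subset_card_eq hP
  have hone' : ∀ p ∈ P', ∀ q ∈ Q, ∀ q' ∈ Q, ¬ R p q → ¬ R p q' → q = q' :=
    fun p hp => hone p (hP'P hp)
  obtain ⟨q₁, hq₁, hfew⟩ := exists_forall_ne_card_missing_le hk hP'
    (Finset.card_pos.1 (by omega)) hone'
  obtain ⟨q₂, hq₂, hne⟩ := Finset.exists_mem_ne (show 1 < Q.card by omega) q₁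
  have h := of_missing_at_most_one_insert (Q := Q.erase q₂) (y := q₂) (R := R) hk hP'
    (by rw [Finset.card_erase_of_mem hq₂]; omega) (by simp)
    (fun p hp q hq q' hq' =>
      hone' p hp q (Finset.mem_of_mem_erase hq) q' (Finset.mem_of_mem_erase hq')) (by
      have := hfew q₂ hq₂ hne
      have := Finset.card_filter_add_card_filter_not (s := P') fun x => R x q₂
      omega)
  rw [Finset.insert_erase hq₂] at h
  exact h.mono hP'P subset_rfl

end HasBipartiteCycleOn

open HasBipartiteCycleOn

open Classical in
theorem exists_cycle_of_card_eq {α β : Type*} {R : α → β → Prop} {m : ℕ} {X S : Finset α}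
    {Y T : Finset β} (hm : 5 ≤ m) (hX : X.card = m) (hY : Y.card = m) (hS : m ≤ S.card)
    (hT : m ≤ T.card) (hYT : Disjoint Y T)
    (hedge : ∀ x ∈ X, ∀ y ∈ Y, ∀ s ∈ S, ∀ t ∈ T, ¬ R x t → ¬ R s y → R x y)
    (hone : ∀ x ∈ X, ∀ t ∈ T, ∀ t' ∈ T, ¬ R x t → ¬ R x t' → t = t') :
    ∃ P Q, HasBipartiteCycleOn m R P Q := by
  by_cases hfew : ∀ t ∈ T, (X.filter fun x => ¬ R x t).card + 3 ≤ m
  · obtain ⟨Q, hQT, hQ⟩ := Finset.exists_subset_card_eq hT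
    obtain ⟨q, hq⟩ := Finset.card_pos.1 (show 0 < Q.card by omega)
    refine ⟨X, Q, of_few_missing (by omega) hX.ge hQ hq ?_ (fun t ht _ => hfew t (hQT ht))
      fun p hp t ht _ t' ht' _ => hone p hp t (hQT ht) t' (hQT ht')⟩
    have := hfew q (hQT hq)
    have := Finset.card_filter_add_card_filter_not (s := X) fun x => R x q
    omega
  push Not at hfew
  obtain ⟨t, ht, htcard⟩ := hfew
  by_cases hc : ∃ y ∈ Y, ∃ s ∈ S, ¬ R s y
  · obtain ⟨y, hy, s, hs, hsy⟩ := hc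
    refine ⟨X, insert y T, of_missing_at_most_one_insert hm hX hT
      (Finset.disjoint_left.1 hYT hy) hone ?_⟩
    have : (X.filter fun x => ¬ R x t).card ≤ (X.filter fun x => R x y).card := by
      refine Finset.card_le_card fun x hx => ?_
      rw [Finset.mem_filter] at hx ⊢
      exact ⟨hx.1, hedge x hx.1 y hy s hs t ht hx.2 hsy⟩
    omega
  · push Not at hc
    obtain ⟨P, hPS, hP⟩ := Finset.exists_subset_card_eq hS
    exact ⟨P, Y, of_forall (by omega) hP hY fun s hs y hy => hc y hy s (hPS hs)⟩

open Classical in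
theorem exists_cycle_of_card_eq_add_one {α β : Type*} {R : α → β → Prop} {m : ℕ} {X S : Finset α}
    {Y T : Finset β} (hm : 5 ≤ m) (hX : X.card = m + 1) (hY : Y.card = m + 1)
    (hS : S.card = m - 1) (hT : T.card = m - 1) (hXS : Disjoint X S) (hYT : Disjoint Y T)
    (hedge : ∀ x ∈ X, ∀ y ∈ Y, ∀ s ∈ S, ∀ t ∈ T, ¬ R x t → ¬ R s y → R x y)
    (hone : ∀ x ∈ X, ∀ t ∈ T, ∀ t' ∈ T, ¬ R x t → ¬ R x t' → t = t') :
    (∃ P Q, HasBipartiteCycleOn m R P Q) ∨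
      ∃ P Q, HasBipartiteCycleOn m (fun x y => ¬ R x y) P Q := by
  by_contra! hcon
  obtain ⟨hred, hblue⟩ := hcon
  have hsplit : ∀ y, (X.filter fun x => R x y).card + (X.filter fun x => ¬ R x y).card = m + 1 :=
    fun y => by rw [← hX]; exact Finset.card_filter_add_card_filter_not _
  have hYT' : ∀ y ∈ Y, y ∉ T := fun y hy => Finset.disjoint_left.1 hYT hy
  have hcomplete : ∀ B ⊆ Y, m ≤ B.card → (∀ y ∈ B, ∀ s ∈ S, R s y) → ∀ x ∈ X,
      (B.filter fun y => R x y).card ≤ 1 := by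
    intro B hB hBcard hBS x hx
    by_contra! hx2
    refine hred _ _ (of_few_missing (R := fun y x => R x y) (P := B) (Q := insert x S) (q₀ := x)
      (by omega) hBcard ?_ (by simp) hx2 ?_ ?_).flip
    · rw [Finset.card_insert_of_notMem (Finset.disjoint_left.1 hXS hx)]
      omega
    · intro s hs hsx
      have hs' := Finset.mem_of_mem_insert_of_ne hs hsx
      rw [Finset.filter_false_of_mem fun y hy => not_not.2 (hBS y hy s hs')]
      simp
      omega
    · intro y hy s hs hsx _ _ _ h
      exact absurd (hBS y hy s (Finset.mem_of_mem_insert_of_ne hs hsx)) h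
  by_cases hc : ∀ y ∈ Y, ∀ s ∈ S, R s y
  · have hle := hcomplete Y subset_rfl (by omega) hc
    refine hblue X Y (of_missing_at_most_one hm (by omega) (by omega) ?_)
    intro x hx y hy y' hy' h h'
    exact Finset.card_le_one.1 (hle x hx) y (Finset.mem_filter.2 ⟨hy, not_not.1 h⟩) y'
      (Finset.mem_filter.2 ⟨hy', not_not.1 h'⟩)
  push Not at hc
  obtain ⟨y₀, hy₀, s₀, hs₀, hsy₀⟩ := hc
  by_cases hfew : ∀ t ∈ T, (X.filter fun x => ¬ R x t).card + 3 ≤ m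
  · have hy : ∃ y ∈ Y, 2 ≤ (X.filter fun x => R x y).card := by
      by_contra! hle
      refine hblue _ _ (of_missing_at_most_one (R := fun y x => ¬ R x y) (P := Y) (Q := X) hm
        (by omega) (by omega) ?_).flip
      intro y hy x hx x' hx' h h'
      exact Finset.card_le_one.1 (Nat.le_of_lt_succ (hle y hy)) x
        (Finset.mem_filter.2 ⟨hx, not_not.1 h⟩) x' (Finset.mem_filter.2 ⟨hx', not_not.1 h'⟩)
    obtain ⟨y, hy, hy2⟩ := hy
    refine hred X (insert y T) (of_few_missing (by omega) (by omega) ?_ (by simp) hy2 ?_ ?_)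
    · rw [Finset.card_insert_of_notMem (hYT' y hy)]
      omega
    · exact fun t ht hty => hfew t (Finset.mem_of_mem_insert_of_ne ht hty)
    · exact fun x hx t ht hty t' ht' hty' => hone x hx t (Finset.mem_of_mem_insert_of_ne ht hty)
        t' (Finset.mem_of_mem_insert_of_ne ht' hty')
  push Not at hfew
  obtain ⟨t₀, ht₀, htcard⟩ := hfew
  have honeY : ∀ y ∈ Y, ∀ s ∈ S, ¬ R s y → ∀ x ∈ X, ∀ t ∈ insert y T, ∀ t' ∈ insert y T,
      ¬ R x t → ¬ R x t' → t = t' := by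
    intro y hy s hs hsy x hx t ht t' ht' h h'
    rcases Finset.mem_insert.1 ht with hty | htT <;>
      rcases Finset.mem_insert.1 ht' with hty' | htT'
    · rw [hty, hty']
    · exact absurd (hedge x hx y hy s hs t' htT' h' hsy) (hty ▸ h)
    · exact absurd (hedge x hx y hy s hs t htT h hsy) (hty' ▸ h')
    · exact hone x hx t htT t' htT' h h'
  have hy₀t₀ : y₀ ≠ t₀ := fun h => hYT' y₀ hy₀ (h ▸ ht₀)
  have hXt := hsplit t₀
  rcases Nat.lt_or_ge (X.filter fun x => ¬ R x t₀).card m with hlt | hge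
  · obtain ⟨W, hW, hWcard⟩ := Finset.exists_subset_card_eq
      (show 2 ≤ (X.filter fun x => R x t₀).card by omega)
    have hWX : W ⊆ X := hW.trans (Finset.filter_subset _ _)
    have hPX : (X.filter fun x => ¬ R x t₀) ∪ W ⊆ X :=
      Finset.union_subset (Finset.filter_subset _ _) hWX
    have hone₀ := honeY y₀ hy₀ s₀ hs₀ hsy₀
    refine hred ((X.filter fun x => ¬ R x t₀) ∪ W) (insert y₀ T)
      (of_few_missing (q₀ := t₀) (by omega) ?_ ?_ (by simp [ht₀]) ?_ ?_ ?_)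
    · rw [Finset.card_union_of_disjoint]
      · omega
      · refine Finset.disjoint_left.2 fun x hx hxW => ?_
        exact (Finset.mem_filter.1 hx).2 (Finset.mem_filter.1 (hW hxW)).2
    · rw [Finset.card_insert_of_notMem (hYT' y₀ hy₀)]
      omega
    · rw [← hWcard]
      exact Finset.card_le_card fun x hx => Finset.mem_filter.2
        ⟨Finset.mem_union_right _ hx, (Finset.mem_filter.1 (hW hx)).2⟩
    · intro q hq hqt
      have : ((X.filter fun x => ¬ R x t₀) ∪ W).filter (fun x => ¬ R x q) ⊆ W := by
        intro x hx
        rw [Finset.mem_filter, Finset.mem_union] at hx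
        rcases hx with ⟨hx | hx, hxq⟩
        · rw [Finset.mem_filter] at hx
          exact absurd (hone₀ x hx.1 q hq t₀ (by simp [ht₀]) hxq hx.2) hqt
        · exact hx
      have := Finset.card_le_card this
      omega
    · exact fun x hx t ht _ t' ht' _ => hone₀ x (hPX hx) t ht t' ht'
  by_cases hc : ∃ y₁ ∈ Y, y₁ ≠ y₀ ∧ ∃ s ∈ S, ¬ R s y₁
  · obtain ⟨y₁, hy₁, hne, s₁, hs₁, hsy₁⟩ := hc
    have hsub : ∀ q ∈ insert y₁ (insert y₀ (T.erase t₀)), q ≠ y₁ → q ∈ insert y₀ T ∧ q ≠ t₀ := by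
      intro q hq hqy
      rcases Finset.mem_insert.1 (Finset.mem_of_mem_insert_of_ne hq hqy) with rfl | hq
      · exact ⟨by simp, hy₀t₀⟩
      · exact ⟨Finset.mem_insert_of_mem (Finset.mem_of_mem_erase hq), Finset.ne_of_mem_erase hq⟩
    refine hred X (insert y₁ (insert y₀ (T.erase t₀)))
      (of_few_missing (q₀ := y₁) (by omega) (by omega) ?_ (by simp) ?_ ?_ ?_)
    · rw [Finset.card_insert_of_notMem, Finset.card_insert_of_notMem,
        Finset.card_erase_of_mem ht₀]
      · omega
      · exact fun h => hYT' y₀ hy₀ (Finset.mem_of_mem_erase h)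
      · intro h
        exact hYT' y₁ hy₁ (Finset.mem_of_mem_erase (Finset.mem_of_mem_insert_of_ne h hne))
    · have : (X.filter fun x => ¬ R x t₀).card ≤ (X.filter fun x => R x y₁).card := by
        refine Finset.card_le_card fun x hx => ?_
        rw [Finset.mem_filter] at hx ⊢
        exact ⟨hx.1, hedge x hx.1 y₁ hy₁ s₁ hs₁ t₀ ht₀ hx.2 hsy₁⟩
      omega
    · intro q hq hqy
      obtain ⟨hqT, hqt⟩ := hsub q hq hqy
      have : (X.filter fun x => ¬ R x q).card ≤ (X.filter fun x => R x t₀).card := by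
        refine Finset.card_le_card fun x hx => ?_
        rw [Finset.mem_filter] at hx ⊢
        refine ⟨hx.1, by_contra fun h => hqt ?_⟩
        exact honeY y₀ hy₀ s₀ hs₀ hsy₀ x hx.1 q hqT t₀ (by simp [ht₀]) hx.2 h
      omega
    · exact fun x hx t ht hty t' ht' hty' => honeY y₀ hy₀ s₀ hs₀ hsy₀ x hx t (hsub t ht hty).1
        t' (hsub t' ht' hty').1
  · push Not at hc
    have hB : (Y.erase y₀).card = m := by
      rw [Finset.card_erase_of_mem hy₀]
      omega
    have hle := hcomplete (Y.erase y₀) (Finset.erase_subset _ _) hB.ge fun y hy =>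
      hc y (Finset.mem_of_mem_erase hy) (Finset.ne_of_mem_erase hy)
    obtain ⟨P, hPX, hP⟩ := Finset.exists_subset_card_eq hge
    refine hblue _ _ (of_missing_at_most_one_insert (P := P) (Q := Y.erase y₀) (y := t₀) hm hP
      hB.ge (fun h => hYT' t₀ (Finset.mem_of_mem_erase h) ht₀) ?_ ?_)
    · intro x hx y hy y' hy' h h'
      exact Finset.card_le_one.1 (hle x (Finset.mem_filter.1 (hPX hx)).1) y
        (Finset.mem_filter.2 ⟨hy, not_not.1 h⟩) y' (Finset.mem_filter.2 ⟨hy', not_not.1 h'⟩)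
    · refine (show 2 ≤ P.card by omega).trans (Finset.card_le_card fun x hx => ?_)
      simp only [Finset.mem_filter]
      exact ⟨hx, (Finset.mem_filter.1 (hPX hx)).2⟩

theorem exists_cycle_of_missing_at_most_one {α β : Type*} [Fintype α] [Fintype β]
    [DecidableEq α] [DecidableEq β] {R : α → β → Prop} {m n N : ℕ} {S : Finset α} {T : Finset β}
    (hm : 5 ≤ m) (hmn : m ≤ n) (hNeq : m = n → N = m + n) (hNlt : m + 1 ≤ n → N = m + n - 1)
    (hα : Fintype.card α = N) (hβ : Fintype.card β = N) (hS : S.card = n - 1)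
    (hT : T.card = n - 1)
    (hedge : ∀ x ∈ Sᶜ, ∀ y ∈ Tᶜ, ∀ s ∈ S, ∀ t ∈ T, ¬ R x t → ¬ R s y → R x y)
    (hone : ∀ x ∈ Sᶜ, ∀ t ∈ T, ∀ t' ∈ T, ¬ R x t → ¬ R x t' → t = t') :
    (∃ P Q, HasBipartiteCycleOn m R P Q) ∨
      ∃ P Q, HasBipartiteCycleOn n (fun x y => ¬ R x y) P Q := by
  have hSc := Finset.card_compl S
  have hTc := Finset.card_compl T
  rcases hmn.eq_or_lt with rfl | hlt
  · have := hNeq rfl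
    exact exists_cycle_of_card_eq_add_one hm (by omega) (by omega) hS hT disjoint_compl_left
      disjoint_compl_left hedge hone
  · have := hNlt hlt
    exact Or.inl (exists_cycle_of_card_eq hm (by omega) (by omega) (by omega) (by omega)
      disjoint_compl_left hedge hone)

/-- Let `m, n ≥ 5` with `N = m + n` if `m = n` and `N = m + n - 1` if `n ≥ m + 1`.
If a red/blue coloring of `K_{N,N}` has neither a blue `C_{2n}` nor a red `C_{2m}`,
then the blue graph contains no `K_{n-1, n-1}`. -/
theorem no_blue_Knn (m n N : ℕ) (hm : 5 ≤ m) (hmn : m ≤ n)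
    (hNeq : m = n → N = m + n) (hNlt : m + 1 ≤ n → N = m + n - 1)
    (red : SimpleGraph (Fin N ⊕ Fin N))
    (hred : red ≤ completeBipartiteGraph (Fin N) (Fin N))
    (hnoblue : ¬ hasCycleLength (completeBipartiteGraph (Fin N) (Fin N) \ red) (2 * n))
    (hnored : ¬ hasCycleLength red (2 * m)) :
    ¬ ∃ (S T : Finset (Fin N)), S.card = n - 1 ∧ T.card = n - 1 ∧
      ∀ a ∈ S, ∀ b ∈ T,
        (completeBipartiteGraph (Fin N) (Fin N) \ red).Adj (Sum.inl a) (Sum.inr b) := by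
  classical
  rintro ⟨S, T, hS, hT, hST⟩
  set R : Fin N → Fin N → Prop := fun x y => red.Adj (Sum.inl x) (Sum.inr y)
  have hred' : ∀ P Q, ¬ HasBipartiteCycleOn m R P Q := fun P Q h =>
    hnored (h.toHasCycleLength (by omega) fun _ _ => id)
  have hblue' : ∀ P Q, ¬ HasBipartiteCycleOn n (fun x y => ¬ R x y) P Q := fun P Q h =>
    hnoblue (h.toHasCycleLength (by omega) fun x y hxy => by
      rw [SimpleGraph.sdiff_adj]
      exact ⟨Or.inl ⟨rfl, rfl⟩, hxy⟩)
  have hST' : ∀ s ∈ S, ∀ t ∈ T, ¬ R s t := fun s hs t ht => by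
    have := hST s hs t ht
    rw [SimpleGraph.sdiff_adj] at this
    exact this.2
  have hext : ∀ x ∈ Sᶜ, ∀ y ∈ Tᶜ, ∀ q ∈ insert y T, ∀ q' ∈ insert y T, q ≠ q' →
      ¬ R x q → ¬ R x q' → ∀ p ∈ insert x S, ∀ p' ∈ insert x S, p ≠ p' →
      ¬ R p y → ¬ R p' y → False := by
    intro x hx y hy q hq q' hq' hqq' hxq hxq' p hp p' hp' hpp' hpy hpy'
    refine hblue' _ _ (of_insert_insert (by omega) hS hT (Finset.mem_compl.1 hx)
      (Finset.mem_compl.1 hy) hST' ?_ ?_)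
    · exact Finset.one_lt_card.2 ⟨q, by simp only [Finset.mem_filter]; exact ⟨hq, hxq⟩, q',
        by simp only [Finset.mem_filter]; exact ⟨hq', hxq'⟩, hqq'⟩
    · exact Finset.one_lt_card.2 ⟨p, by simp only [Finset.mem_filter]; exact ⟨hp, hpy⟩, p',
        by simp only [Finset.mem_filter]; exact ⟨hp', hpy'⟩, hpp'⟩
  have hedge : ∀ x ∈ Sᶜ, ∀ y ∈ Tᶜ, ∀ s ∈ S, ∀ t ∈ T, ¬ R x t → ¬ R s y → R x y := by
    intro x hx y hy s hs t ht hxt hsy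
    by_contra hxy
    exact hext x hx y hy t (Finset.mem_insert_of_mem ht) y (Finset.mem_insert_self _ _)
      (fun h => Finset.mem_compl.1 hy (h ▸ ht)) hxt hxy s (Finset.mem_insert_of_mem hs) x
      (Finset.mem_insert_self _ _) (fun h => Finset.mem_compl.1 hx (h ▸ hs)) hsy hxy
  by_cases hone : ∀ x ∈ Sᶜ, ∀ t ∈ T, ∀ t' ∈ T, ¬ R x t → ¬ R x t' → t = t'
  · rcases exists_cycle_of_missing_at_most_one hm hmn hNeq hNlt (Fintype.card_fin N)
      (Fintype.card_fin N) hS hT hedge hone with ⟨P, Q, h⟩ | ⟨P, Q, h⟩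
    · exact hred' P Q h
    · exact hblue' P Q h
  · push Not at hone
    obtain ⟨x, hx, t, ht, t', ht', hxt, hxt', hne⟩ := hone
    rcases exists_cycle_of_missing_at_most_one (R := fun y x => R x y) hm hmn hNeq hNlt
      (Fintype.card_fin N) (Fintype.card_fin N) hT hS
      (fun y hy x hx t ht s hs hsy hxt => hedge x hx y hy s hs t ht hxt hsy)
      (fun y hy s hs s' hs' hsy hsy' => by_contra fun hss' =>
        hext x hx y hy t (Finset.mem_insert_of_mem ht) t' (Finset.mem_insert_of_mem ht') hne hxt
          hxt' s (Finset.mem_insert_of_mem hs) s' (Finset.mem_insert_of_mem hs') hss' hsy hsy')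
      with ⟨P, Q, h⟩ | ⟨P, Q, h⟩
    · exact hred' Q P h.flip
    · exact hblue' Q P h.flip
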